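/- Let T be a tree of order t with at least s+1 leaves, where 2 ≤ s ≤ t - 2. Then for every nonincreasing graphic sequence π of length n = t + s - 2, either π is potentially T-graphic or the complementary sequence π̄ is potentially K_s-graphic. -/

import Mathlib

open SimpleGraph
open scoped Classical

/-- Degree of a vertex. -/
noncomputable def deg {V : Type} (G : SimpleGraph V) (v : V) : ℕ := Nat.card (G.neighborSet v)

/-- Number of vertices of degree exactly 1 (leaves for trees/forests). -/
noncomputable def numLeaves {V : Type} (G : SimpleGraph V) : ℕ := Nat.card {v : V // deg G v = 1}

/-- Number of connected components containing at least one edge. -/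
noncomputable def numEdgeComps {V : Type} (G : SimpleGraph V) : ℕ :=
  Nat.card {c : G.ConnectedComponent // ∃ v w : V, G.Adj v w ∧ G.connectedComponentMk v = c}

/-- Maximum degree. -/
noncomputable def maxDeg {V : Type} (G : SimpleGraph V) : ℕ := sSup (Set.range (deg G))

/-- `G` and `H` pack: a bijection sends edges of `H` to non-edges of `G`. -/
def Packs {V W : Type} (G : SimpleGraph V) (H : SimpleGraph W) : Prop :=
  ∃ f : W ≃ V, ∀ x y : W, H.Adj x y → ¬ G.Adj (f x) (f y)

/-- `G` contains a copy of `H` as a subgraph. -/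
def ContainsCopy {V W : Type} (G : SimpleGraph V) (H : SimpleGraph W) : Prop :=
  ∃ f : W ↪ V, ∀ x y : W, H.Adj x y → G.Adj (f x) (f y)

/-- `G` realizes the degree sequence `π`. -/
def IsRealization {n : ℕ} (G : SimpleGraph (Fin n)) (π : Fin n → ℕ) : Prop :=
  ∀ i, deg G i = π i

/-- `π` is a graphic sequence. -/
def Graphic {n : ℕ} (π : Fin n → ℕ) : Prop :=
  ∃ G : SimpleGraph (Fin n), IsRealization G π

/-- `π` is potentially `H`-graphic. -/
def PotentiallyGraphic {n : ℕ} {W : Type} (π : Fin n → ℕ) (H : SimpleGraph W) : Prop :=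
  ∃ G : SimpleGraph (Fin n), IsRealization G π ∧ ContainsCopy G H

/-- The complementary sequence `π̄ = (n-1-d_n, …, n-1-d_1)`. -/
def compSeq {n : ℕ} (π : Fin n → ℕ) : Fin n → ℕ := fun i => n - 1 - π i.rev

/-- The potential-Ramsey number. -/
noncomputable def rpot {W₁ W₂ : Type} (H₁ : SimpleGraph W₁) (H₂ : SimpleGraph W₂) : ℕ :=
  sInf {N : ℕ | ∀ π : Fin N → ℕ, Antitone π → Graphic π →
    PotentiallyGraphic π H₁ ∨ PotentiallyGraphic (compSeq π) H₂}

/-- The star `K_{1,t-1}` on `t` vertices, centered at vertex `0`. -/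
def starGraph (t : ℕ) : SimpleGraph (Fin t) := SimpleGraph.fromRel (fun i _ => (i : ℕ) = 0)

section DegreeMoves

variable {V : Type} [Fintype V]

/-- The neighbors of a vertex, as a finset. -/
noncomputable def nbrs (G : SimpleGraph V) (v : V) : Finset V := Finset.univ.filter (G.Adj v)

@[simp]
lemma mem_nbrs {G : SimpleGraph V} {v x : V} : x ∈ nbrs G v ↔ G.Adj v x := by
  simp [nbrs]

lemma deg_eq_card (G : SimpleGraph V) (v : V) : deg G v = (nbrs G v).card := by
  rw [deg, Nat.card_eq_fintype_card, Fintype.card_subtype]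
  rfl

lemma exists_delete {G : SimpleGraph V} {x u : V} (h : G.Adj x u) :
    ∃ G' : SimpleGraph V,
      (∀ a b, G'.Adj a b ↔ G.Adj a b ∧ ¬(a = x ∧ b = u) ∧ ¬(a = u ∧ b = x)) ∧
      ∀ z, deg G' z + (if z = x then 1 else 0) + (if z = u then 1 else 0) = deg G z := by
  have hxu := h.ne
  have hadj : ∀ a b, (G \ edge x u).Adj a b ↔
      G.Adj a b ∧ ¬(a = x ∧ b = u) ∧ ¬(a = u ∧ b = x) := by
    intro a b
    rw [sdiff_adj, edge_adj]
    grind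
  refine ⟨_, hadj, fun z => ?_⟩
  rw [deg_eq_card, deg_eq_card]
  by_cases h1 : z = x
  · subst h1
    have : nbrs (G \ edge z u) z = (nbrs G z).erase u := by
      ext b; simp only [mem_nbrs, Finset.mem_erase, hadj]; grind
    rw [this, if_pos rfl, if_neg hxu, add_zero, Finset.card_erase_add_one (by simpa using h)]
  by_cases h2 : z = u
  · subst h2
    have : nbrs (G \ edge x z) z = (nbrs G z).erase x := by
      ext b; simp only [mem_nbrs, Finset.mem_erase, hadj]; grind
    rw [this, if_pos rfl, if_neg h1, add_zero, Finset.card_erase_add_one (by simpa using h.symm)]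
  · rw [if_neg h1, if_neg h2]
    have : nbrs (G \ edge x u) z = nbrs G z := by
      ext b; simp only [mem_nbrs, hadj]; grind
    rw [this, add_zero, add_zero]

lemma exists_insert {G : SimpleGraph V} {x u : V} (h : ¬ G.Adj x u) (hxu : x ≠ u) :
    ∃ G' : SimpleGraph V,
      (∀ a b, G'.Adj a b ↔ G.Adj a b ∨ (a = x ∧ b = u) ∨ (a = u ∧ b = x)) ∧
      ∀ z, deg G' z = deg G z + (if z = x then 1 else 0) + (if z = u then 1 else 0) := by
  have hadj : ∀ a b, (G ⊔ edge x u).Adj a b ↔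
      G.Adj a b ∨ (a = x ∧ b = u) ∨ (a = u ∧ b = x) := by
    intro a b
    rw [sup_adj, edge_adj]
    grind
  obtain ⟨G₁, h1, h2⟩ := exists_delete ((hadj x u).2 (by simp))
  have : G₁ = G := by
    ext a b
    rw [h1, hadj]
    have := G.adj_comm x u
    grind
  subst this
  exact ⟨_, hadj, fun z => (h2 z).symm⟩

lemma exists_transfer {G : SimpleGraph V} {x u w : V} (h : G.Adj x u) (hw : ¬ G.Adj x w)
    (hxw : x ≠ w) :
    ∃ G' : SimpleGraph V,
      (∀ a b, G'.Adj a b ↔ (G.Adj a b ∧ ¬(a = x ∧ b = u) ∧ ¬(a = u ∧ b = x)) ∨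
        (a = x ∧ b = w) ∨ (a = w ∧ b = x)) ∧
      ∀ z, deg G' z + (if z = u then 1 else 0) = deg G z + (if z = w then 1 else 0) := by
  obtain ⟨G₁, h1, h2⟩ := exists_delete h
  obtain ⟨G₂, h3, h4⟩ := exists_insert (G := G₁) (x := x) (u := w) (by rw [h1]; tauto) hxw
  refine ⟨G₂, fun a b => by rw [h3, h1], fun z => ?_⟩
  have := h2 z
  have := h4 z
  omega

lemma exists_twoSwitch {G : SimpleGraph V} {v x u y : V} (hvx : G.Adj v x) (huy : G.Adj u y)
    (hvu : ¬ G.Adj v u) (hne : v ≠ u) (hxy : ¬ G.Adj x y) (hne' : x ≠ y) :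
    ∃ G' : SimpleGraph V,
      (∀ a b, G'.Adj a b ↔ (G.Adj a b ∧ ¬(a = v ∧ b = x) ∧ ¬(a = x ∧ b = v) ∧
        ¬(a = u ∧ b = y) ∧ ¬(a = y ∧ b = u)) ∨ (a = v ∧ b = u) ∨ (a = u ∧ b = v) ∨
        (a = x ∧ b = y) ∨ (a = y ∧ b = x)) ∧
      ∀ z, deg G' z = deg G z := by
  have hyv : y ≠ v := by rintro rfl; exact hvu huy.symm
  have hxu : x ≠ u := by rintro rfl; exact hvu hvx
  have := huy.ne
  have := hvx.ne
  obtain ⟨G₁, h1, h2⟩ := exists_transfer hvx hvu hne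
  obtain ⟨G₂, h3, h4⟩ := exists_transfer (G := G₁) (x := y) (u := u) (w := x)
    (by rw [h1]; left; refine ⟨huy.symm, ?_, ?_⟩ <;> grind)
    (by rw [h1]; have := G.adj_comm x y; grind) hne'.symm
  refine ⟨G₂, fun a b => by rw [h3, h1]; grind, fun z => ?_⟩
  have := h2 z
  have := h4 z
  omega

lemma deg_lt_of_dominated {G : SimpleGraph V} {a w v : V}
    (h : ∀ x, G.Adj x a → G.Adj x w ∨ x = w) (hvw : G.Adj v w) (hva : ¬ G.Adj v a)
    (hne : v ≠ a) : deg G a < deg G w := by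
  rw [deg_eq_card, deg_eq_card]
  have hsub : (nbrs G a).image (Equiv.swap a w) ⊂
      nbrs G w := by
    rw [Finset.ssubset_iff_of_subset]
    · refine ⟨v, by simpa using hvw.symm, ?_⟩
      simp only [Finset.mem_image, mem_nbrs, not_exists,
        not_and]
      rintro b hb rfl
      have := hb.ne
      rw [Equiv.swap_apply_def] at *
      have := hb.symm
      grind
    · intro y hy
      simp only [Finset.mem_image, mem_nbrs] at hy ⊢
      obtain ⟨b, hb, rfl⟩ := hy
      have h1 := h b hb.symm
      have := hb.ne
      rw [Equiv.swap_apply_def]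
      have := G.adj_comm a w
      have := G.adj_comm b w
      grind
  have := Finset.card_lt_card hsub
  rwa [Finset.card_image_of_injective _ (Equiv.injective _)] at this

lemma exists_adj_of_deg_le {G : SimpleGraph V} {a w v : V} (hle : deg G w ≤ deg G a)
    (hvw : G.Adj v w) (hva : ¬ G.Adj v a) (hne : v ≠ a) :
    ∃ x, G.Adj x a ∧ ¬ G.Adj x w ∧ x ≠ w := by
  by_contra! hcon
  have := deg_lt_of_dominated (fun x hx => or_iff_not_imp_left.2 (hcon x hx)) hvw hva hne
  omega

lemma exists_adj_of_deg_lt {G : SimpleGraph V} {a w : V} (hlt : deg G w < deg G a) :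
    ∃ x, G.Adj x a ∧ ¬ G.Adj x w ∧ x ≠ w := by
  by_contra! hcon
  have hle : deg G a ≤ deg G w := by
    rw [deg_eq_card, deg_eq_card]
    have hsub : (nbrs G a).image (Equiv.swap a w) ⊆
        nbrs G w := by
      intro y hy
      simp only [Finset.mem_image, mem_nbrs] at hy ⊢
      obtain ⟨b, hb, rfl⟩ := hy
      have h1 := hcon b hb.symm
      have := hb.ne
      rw [Equiv.swap_apply_def]
      have := G.adj_comm a w
      have := G.adj_comm b w
      grind
    have := Finset.card_le_card hsub
    rwa [Finset.card_image_of_injective _ (Equiv.injective _)] at this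
  omega

lemma exists_realign (B : Finset V) (v : V) (G : SimpleGraph V) (hv : v ∉ B)
    (hB : B.card = deg G v) (htop : ∀ b ∈ B, ∀ x ∉ B, x ≠ v → deg G x ≤ deg G b) :
    ∃ G' : SimpleGraph V, (∀ z, deg G' z = deg G z) ∧ ∀ z, G'.Adj v z ↔ z ∈ B := by
  induction hk : (B.filter (fun b => ¬ G.Adj v b)).card using Nat.strong_induction_on
    generalizing G with
  | _ k ih =>
  by_cases hall : ∀ b ∈ B, G.Adj v b
  · refine ⟨G, fun _ => rfl, fun z => ⟨fun hz => ?_, hall z⟩⟩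
    have hsub : B ⊆ nbrs G v := fun b hb => by simpa using hall b hb
    have := Finset.eq_of_subset_of_card_le hsub (by rw [hB, deg_eq_card])
    rw [this]; simpa using hz
  · push Not at hall
    obtain ⟨b, hb, hvb⟩ := hall
    have hvb' : v ≠ b := by rintro rfl; exact hv hb
    obtain ⟨x, hx, hxB⟩ : ∃ x, G.Adj v x ∧ x ∉ B := by
      by_contra! hcon
      have hsub : nbrs G v ⊆ B := fun x hx => hcon x (by simpa using hx)
      have := Finset.eq_of_subset_of_card_le hsub (by rw [hB, deg_eq_card])
      rw [← this] at hb
      exact hvb (by simpa using hb)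
    obtain ⟨y, hyb, hyx, hne⟩ := exists_adj_of_deg_le (htop b hb x hxB hx.ne') hx hvb hvb'
    obtain ⟨G', h1, h2⟩ := exists_twoSwitch hx hyb.symm hvb hvb' (fun h => hyx h.symm) hne.symm
    have hlt : (B.filter (fun b => ¬ G'.Adj v b)).card < k := by
      rw [← hk]
      apply Finset.card_lt_card
      rw [Finset.ssubset_iff_of_subset]
      · exact ⟨b, by simp [hb, hvb], by simp [h1]⟩
      · intro z hz
        simp only [Finset.mem_filter, h1] at hz ⊢
        refine ⟨hz.1, fun hvz => hz.2 (Or.inl ⟨hvz, ?_⟩)⟩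
        grind
    obtain ⟨G'', h3, h4⟩ := ih _ hlt G' (by rw [h2, hB]) (by simpa only [h2] using htop) rfl
    exact ⟨G'', fun z => by rw [h3, h2], h4⟩

end DegreeMoves

section LayOff

variable {V : Type} [Fintype V]

lemma exists_top_subset {α : Type} (g : α → ℕ) (C : Finset α) (k : ℕ) (hk : k ≤ C.card) :
    ∃ B ⊆ C, B.card = k ∧ ∀ b ∈ B, ∀ x ∈ C, x ∉ B → g x ≤ g b := by
  induction k with
  | zero => exact ⟨∅, by simp, by simp, by simp⟩
  | succ k ih =>
    obtain ⟨B, hBC, hB, htop⟩ := ih (by omega)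
    have hne : (C \ B).Nonempty := by
      rw [← Finset.card_pos, Finset.card_sdiff_of_subset hBC]
      omega
    obtain ⟨m, hm, hmax⟩ := Finset.exists_max_image (C \ B) g hne
    rw [Finset.mem_sdiff] at hm
    refine ⟨insert m B, Finset.insert_subset hm.1 hBC, by
      rw [Finset.card_insert_of_notMem hm.2, hB], fun b hb x hx hxB => ?_⟩
    rw [Finset.mem_insert, not_or] at hxB
    rcases Finset.mem_insert.1 hb with rfl | hb
    · exact hmax x (Finset.mem_sdiff.2 ⟨hx, hxB.2⟩)
    · exact htop b hb x hx hxB.2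

lemma exists_isolate (G : SimpleGraph V) (v : V) :
    ∃ G' : SimpleGraph V, (∀ a b, G'.Adj a b ↔ G.Adj a b ∧ a ≠ v ∧ b ≠ v) ∧
      deg G' v = 0 ∧ ∀ z, z ≠ v → deg G' z + (if G.Adj v z then 1 else 0) = deg G z := by
  let G' : SimpleGraph V :=
    { Adj := fun a b => G.Adj a b ∧ a ≠ v ∧ b ≠ v
      symm := ⟨fun a b h => ⟨h.1.symm, h.2.2, h.2.1⟩⟩
      loopless := ⟨fun a h => h.1.ne rfl⟩ }
  have hadj : ∀ a b, G'.Adj a b ↔ G.Adj a b ∧ a ≠ v ∧ b ≠ v := fun a b => Iff.rfl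
  refine ⟨G', hadj, ?_, fun z hz => ?_⟩
  · rw [deg_eq_card, Finset.card_eq_zero]
    ext b
    simp [hadj]
  · have : nbrs G' z = (nbrs G z).erase v := by
      ext b
      simp only [mem_nbrs, hadj, Finset.mem_erase]
      tauto
    rw [deg_eq_card, deg_eq_card, this]
    split_ifs with h
    · exact Finset.card_erase_add_one (by simpa using h.symm)
    · rw [Finset.erase_eq_of_notMem (by simpa using fun h' => h (G.adj_symm h')), add_zero]

lemma exists_join {G : SimpleGraph V} {v : V} (hv : deg G v = 0) {B : Finset V} (hB : v ∉ B) :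
    ∃ G' : SimpleGraph V,
      (∀ a b, G'.Adj a b ↔ G.Adj a b ∨ (a = v ∧ b ∈ B) ∨ (b = v ∧ a ∈ B)) ∧
      deg G' v = B.card ∧ ∀ z, z ≠ v → deg G' z = deg G z + (if z ∈ B then 1 else 0) := by
  have hiso : ∀ z, ¬ G.Adj v z := by
    intro z hz
    rw [deg_eq_card, Finset.card_eq_zero] at hv
    have : z ∈ nbrs G v := by simpa using hz
    simp [hv] at this
  let G' : SimpleGraph V :=
    { Adj := fun a b => G.Adj a b ∨ (a = v ∧ b ∈ B) ∨ (b = v ∧ a ∈ B)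
      symm := ⟨fun a b h => by rw [G.adj_comm]; tauto⟩
      loopless := ⟨fun a h => by
        rcases h with h | ⟨rfl, h⟩ | ⟨rfl, h⟩
        · exact h.ne rfl
        · exact hB h
        · exact hB h⟩ }
  have hadj : ∀ a b, G'.Adj a b ↔ G.Adj a b ∨ (a = v ∧ b ∈ B) ∨ (b = v ∧ a ∈ B) :=
    fun a b => Iff.rfl
  have hvv : nbrs G' v = B := by
    ext b
    simp only [mem_nbrs, hadj, hiso, false_or, true_and]
    refine ⟨?_, Or.inl⟩
    rintro (h | ⟨rfl, h⟩) <;> exact h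
  obtain ⟨G₁, h1, h2, h3⟩ := exists_isolate G' v
  have : G₁ = G := by
    ext a b
    rw [h1, hadj]
    have h4 := hiso a
    have h5 := hiso b
    rw [G.adj_comm] at h4
    by_cases ha : a = v <;> by_cases hb : b = v <;> simp_all
  subst this
  refine ⟨G', hadj, by rw [deg_eq_card, hvv], fun z hz => ?_⟩
  simp only [← h3 z hz, ← hvv, mem_nbrs]
  congr

/-- Laying off a vertex: a realization can be rearranged so that `v` is joined to a prescribed
set of vertices of largest degrees, and rearrangements after deleting `v` can be lifted back. -/
lemma exists_layOff (G : SimpleGraph V) {v : V} {B : Finset V} (hv : v ∉ B)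
    (hB : B.card = deg G v) (htop : ∀ b ∈ B, ∀ x ∉ B, x ≠ v → deg G x ≤ deg G b) :
    ∃ G' : SimpleGraph V, deg G' v = 0 ∧
      (∀ z, z ≠ v → deg G' z + (if z ∈ B then 1 else 0) = deg G z) ∧
      ∀ G₁ : SimpleGraph V, (∀ z, deg G₁ z = deg G' z) →
        ∃ G₂ : SimpleGraph V, (∀ z, deg G₂ z = deg G z) ∧ G₁ ≤ G₂ ∧ ∀ b ∈ B, G₂.Adj v b := by
  obtain ⟨H, hH, hHv⟩ := exists_realign B v G hv hB htop
  obtain ⟨G', -, h2, h3⟩ := exists_isolate H v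
  simp only [hHv, hH] at h3
  refine ⟨G', h2, h3, fun G₁ hG₁ => ?_⟩
  obtain ⟨G₂, h4, h5, h6⟩ := exists_join (G := G₁) (by rw [hG₁, h2]) hv
  refine ⟨G₂, fun z => ?_, fun a b h => (h4 a b).2 (Or.inl h),
    fun b hb => (h4 v b).2 (Or.inr (Or.inl ⟨rfl, hb⟩))⟩
  by_cases hz : z = v
  · rw [hz, h5, hB]
  · rw [h6 z hz, hG₁, h3 z hz]

end LayOff

section Construction

variable {V : Type}

lemma even_sum_deg [Fintype V] (G : SimpleGraph V) : Even (∑ v, deg G v) := by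
  have h : ∀ v, deg G v = G.degree v := fun v => by
    rw [deg, Nat.card_eq_fintype_card, card_neighborSet_eq_degree]
  simp only [h, G.sum_degrees_eq_twice_card_edges, even_two_mul]

/-- `F` lives on `S ∪ R`, contains a clique on `S`, and has the prescribed degrees on `S`. -/
structure CliqueAdmissible (S R : Finset V) (f : V → ℕ) (F : SimpleGraph V) : Prop where
  clique : ∀ a ∈ S, ∀ b ∈ S, a ≠ b → F.Adj a b
  supp : ∀ a b, F.Adj a b → a ∈ S ∨ a ∈ R
  degS : ∀ a ∈ S, deg F a = f a

/-- The distance of `deg F` from `f` at `v`. -/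
noncomputable def degError (f : V → ℕ) (F : SimpleGraph V) (v : V) : ℕ :=
  (deg F v - f v) + (f v - deg F v)

/-- An admissible graph whose degrees on `R` are as close to `f` as possible. -/
structure CliqueOptimal (S R : Finset V) (f : V → ℕ) (F : SimpleGraph V) : Prop
    extends CliqueAdmissible S R f F where
  opt : ∀ F', CliqueAdmissible S R f F' → ∑ v ∈ R, degError f F v ≤ ∑ v ∈ R, degError f F' v

variable {S R : Finset V} {f : V → ℕ} {F : SimpleGraph V}

lemma sum_eq_of_eq_off_pair {α : Type} {R : Finset α} {g g' : α → ℕ} {u w : α} (hu : u ∈ R)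
    (hw : w ∈ R) (huw : u ≠ w) (h : ∀ z, z ≠ u → z ≠ w → g' z = g z) :
    ∑ z ∈ R, g' z + g u + g w = ∑ z ∈ R, g z + g' u + g' w := by
  have hw' : w ∈ R.erase u := Finset.mem_erase.2 ⟨huw.symm, hw⟩
  rw [← Finset.add_sum_erase R g' hu, ← Finset.add_sum_erase R g hu,
    ← Finset.add_sum_erase _ g' hw', ← Finset.add_sum_erase _ g hw',
    Finset.sum_congr rfl (g := g) (f := g')]
  · ring
  · intro z hz
    simp only [Finset.mem_erase] at hz
    exact h z hz.2.1 hz.1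

namespace CliqueOptimal

lemma compare (hF : CliqueOptimal S R f F) {F' : SimpleGraph V} (hF' : CliqueAdmissible S R f F')
    {u w : V} (hu : u ∈ R) (hw : w ∈ R) (huw : u ≠ w)
    (h : ∀ z, z ≠ u → z ≠ w → deg F' z = deg F z)
    (hle : degError f F' u + degError f F' w ≤ degError f F u + degError f F w) :
    CliqueOptimal S R f F' ∧
      degError f F' u + degError f F' w = degError f F u + degError f F w := by
  have h1 := sum_eq_of_eq_off_pair (g := degError f F) (g' := degError f F') hu hw huw
    (fun z hz hz' => by rw [degError, degError, h z hz hz'])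
  have h2 := hF.opt F' hF'
  refine ⟨⟨hF', fun F₁ hF₁ => ?_⟩, by omega⟩
  have h3 := hF.opt F₁ hF₁
  omega

end CliqueOptimal

variable [Fintype V]

/-- The degree conditions under which `f` is realized with a clique on `S`. -/
structure CliqueSetup (S R : Finset V) (f : V → ℕ) (s c : ℕ) : Prop where
  disj : ∀ v ∈ S, v ∉ R
  zero : ∀ v, v ∉ S → v ∉ R → f v = 0
  even : Even (∑ v, f v)
  cardS : S.card = s
  s_le : s ≤ c + 1
  R_pos : ∀ r ∈ R, 0 < f r
  R_le : ∀ r ∈ R, f r ≤ c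
  S_ge : ∀ i ∈ S, c ≤ f i
  exists_eq : ∃ a ∈ S, f a = c
  S_le : ∀ i ∈ S, f i + 2 ≤ (R.filter (fun r => f r = c)).card + s
  cases : (R.card = s ∧ ∀ r ∈ R, s ≤ f r + 1) ∨
    (c + 1 = s ∧ s ≤ (R.filter (fun r => f r = c)).card)

variable {s c : ℕ}

lemma CliqueAdmissible.transfer (hS : CliqueSetup S R f s c) (hF : CliqueAdmissible S R f F)
    {x u w : V} (hu : u ∈ R) (hw : w ∈ R) (h : F.Adj x u) (hxw : ¬ F.Adj x w) (hne : x ≠ w) :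
    ∃ F' : SimpleGraph V, CliqueAdmissible S R f F' ∧
      (∀ a b, F'.Adj a b ↔ (F.Adj a b ∧ ¬(a = x ∧ b = u) ∧ ¬(a = u ∧ b = x)) ∨
        (a = x ∧ b = w) ∨ (a = w ∧ b = x)) ∧
      ∀ z, deg F' z + (if z = u then 1 else 0) = deg F z + (if z = w then 1 else 0) := by
  obtain ⟨F', h1, h2⟩ := exists_transfer h hxw hne
  refine ⟨F', ⟨fun a ha b hb hab => ?_, fun a b hab => ?_, fun a ha => ?_⟩, h1, h2⟩
  · have := hS.disj a ha
    have := hS.disj b hb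
    have := hF.clique a ha b hb hab
    grind
  · rcases (h1 a b).1 hab with h | ⟨rfl, rfl⟩ | ⟨rfl, rfl⟩
    · exact hF.supp a b h.1
    · exact hF.supp _ _ h
    · exact Or.inr hw
  · have := hS.disj a ha
    have h3 := h2 a
    rw [if_neg (by grind), if_neg (by grind)] at h3
    rw [← hF.degS a ha]
    exact h3

namespace CliqueOptimal

lemma transfer (hS : CliqueSetup S R f s c) (hF : CliqueOptimal S R f F) {x u w : V}
    (hu : u ∈ R) (hw : w ∈ R) (h : F.Adj x u) (hxw : ¬ F.Adj x w) (hne : x ≠ w)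
    (hex : f u < deg F u ∨ deg F w < f w) :
    ∃ F' : SimpleGraph V, CliqueOptimal S R f F' ∧
      (∀ a b, F'.Adj a b ↔ (F.Adj a b ∧ ¬(a = x ∧ b = u) ∧ ¬(a = u ∧ b = x)) ∨
        (a = x ∧ b = w) ∨ (a = w ∧ b = x)) ∧
      (∀ z, deg F' z + (if z = u then 1 else 0) = deg F z + (if z = w then 1 else 0)) ∧
      ¬ (f u < deg F u ∧ deg F w < f w) := by
  obtain ⟨F', h1, h2, h3⟩ := hF.toCliqueAdmissible.transfer hS hu hw h hxw hne
  have huw : u ≠ w := by rintro rfl; exact hxw h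
  have h4 := h3 u
  have h5 := h3 w
  rw [if_pos rfl, if_neg huw] at h4
  rw [if_pos rfl, if_neg huw.symm] at h5
  obtain ⟨h6, h7⟩ := hF.compare h1 hu hw huw
    (fun z hz hz' => by have := h3 z; rwa [if_neg hz, if_neg hz'] at this)
    (by simp only [degError]; omega)
  refine ⟨F', h6, h2, h3, ?_⟩
  simp only [degError] at h7
  omega

lemma delete (hS : CliqueSetup S R f s c) (hF : CliqueOptimal S R f F) {u r : V}
    (hu : u ∈ R) (hr : r ∈ R) (h : F.Adj u r) (hex : f u < deg F u) :
    ∃ F' : SimpleGraph V, CliqueOptimal S R f F' ∧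
      (∀ z, deg F' z + (if z = u then 1 else 0) + (if z = r then 1 else 0) = deg F z) ∧
      deg F r ≤ f r := by
  obtain ⟨F', h1, h2⟩ := exists_delete h
  have hA : CliqueAdmissible S R f F' := by
    refine ⟨fun a ha b hb hab => ?_, fun a b hab => hF.supp a b ((h1 a b).1 hab).1,
      fun a ha => ?_⟩
    · have := hS.disj a ha
      have := hF.clique a ha b hb hab
      grind
    · have := hS.disj a ha
      have h3 := h2 a
      rw [if_neg (by grind), if_neg (by grind)] at h3
      rw [← hF.degS a ha]
      exact h3
  have h4 := h2 u
  have h5 := h2 r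
  rw [if_pos rfl, if_neg h.ne] at h4
  rw [if_pos rfl, if_neg h.ne'] at h5
  obtain ⟨h6, h7⟩ := hF.compare hA hu hr h.ne
    (fun z hz hz' => by have := h2 z; rwa [if_neg hz, if_neg hz'] at this)
    (by simp only [degError]; omega)
  refine ⟨F', h6, h2, ?_⟩
  simp only [degError] at h7
  omega

lemma insert (hS : CliqueSetup S R f s c) (hF : CliqueOptimal S R f F) {u r : V}
    (hu : u ∈ R) (hr : r ∈ R) (h : ¬ F.Adj u r) (hne : u ≠ r) (hex : deg F u < f u) :
    ∃ F' : SimpleGraph V, CliqueOptimal S R f F' ∧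
      (∀ z, deg F' z = deg F z + (if z = u then 1 else 0) + (if z = r then 1 else 0)) ∧
      f r ≤ deg F r := by
  obtain ⟨F', h1, h2⟩ := exists_insert h hne
  have hA : CliqueAdmissible S R f F' := by
    refine ⟨fun a ha b hb hab => (h1 a b).2 (Or.inl (hF.clique a ha b hb hab)),
      fun a b hab => ?_, fun a ha => ?_⟩
    · rcases (h1 a b).1 hab with h | ⟨rfl, rfl⟩ | ⟨rfl, rfl⟩
      · exact hF.supp a b h
      · exact Or.inr hu
      · exact Or.inr hr
    · have := hS.disj a ha
      have h3 := h2 a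
      rw [if_neg (by grind), if_neg (by grind)] at h3
      rw [← hF.degS a ha]
      exact h3
  have h4 := h2 u
  have h5 := h2 r
  rw [if_pos rfl, if_neg hne] at h4
  rw [if_pos rfl, if_neg hne.symm] at h5
  obtain ⟨h6, h7⟩ := hF.compare hA hu hr hne
    (fun z hz hz' => by have := h2 z; rwa [if_neg hz, if_neg hz'] at this)
    (by simp only [degError]; omega)
  refine ⟨F', h6, h2, ?_⟩
  simp only [degError] at h7
  omega

end CliqueOptimal

lemma CliqueSetup.parity (hS : CliqueSetup S R f s c) {u : V}
    (h : (∀ z, deg F z = f z + (if z = u then 1 else 0)) ∨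
      ∀ z, deg F z + (if z = u then 1 else 0) = f z) : False := by
  have h1 := even_sum_deg F
  have h2 := hS.even
  rcases h with h | h
  · have h3 : ∑ z, deg F z = ∑ z, f z + 1 := by
      simp [h, Finset.sum_add_distrib]
    rw [h3] at h1
    exact (Nat.even_add_one.1 h1) h2
  · have h3 : ∑ z, f z = ∑ z, deg F z + 1 := by
      simp [← h, Finset.sum_add_distrib]
    rw [h3] at h2
    exact (Nat.even_add_one.1 h2) h1

lemma CliqueAdmissible.exists_not_adj (hS : CliqueSetup S R f s c)
    (hF : CliqueAdmissible S R f F) {i : V} (hi : i ∈ S) :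
    ∃ u ∈ R, f u = c ∧ ¬ F.Adj i u := by
  by_contra! hcon
  have hsub : S.erase i ∪ R.filter (fun r => f r = c) ⊆ nbrs F i := by
    intro b hb
    simp only [Finset.mem_union, Finset.mem_erase, Finset.mem_filter, mem_nbrs] at hb ⊢
    rcases hb with hb | hb
    · exact hF.clique i hi b hb.2 hb.1.symm
    · exact hcon b hb.1 hb.2
  have hd : Disjoint (S.erase i) (R.filter (fun r => f r = c)) := by
    rw [Finset.disjoint_left]
    intro a ha ha'
    exact hS.disj a (Finset.mem_of_mem_erase ha) (Finset.mem_filter.1 ha').1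
  have h1 := Finset.card_le_card hsub
  rw [Finset.card_union_of_disjoint hd, ← deg_eq_card, hF.degS i hi,
    Finset.card_erase_of_mem hi, hS.cardS] at h1
  have := hS.S_le i hi
  omega

lemma CliqueAdmissible.deg_eq_zero (hF : CliqueAdmissible S R f F) {v : V} (hv : v ∉ S)
    (hv' : v ∉ R) : deg F v = 0 := by
  rw [deg_eq_card, Finset.card_eq_zero, Finset.eq_empty_iff_forall_notMem]
  intro b hb
  rcases hF.supp v b (mem_nbrs.1 hb) with h | h
  · exact hv h
  · exact hv' h

namespace CliqueOptimal

lemma lt_of_mixed (hS : CliqueSetup S R f s c) (hF : CliqueOptimal S R f F) {u w : V}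
    (hu : u ∈ R) (hw : w ∈ R) (hue : f u < deg F u) (hwd : deg F w < f w) : f u < f w := by
  by_contra! hle
  obtain ⟨x, hxu, hxw, hne⟩ := exists_adj_of_deg_lt (G := F) (a := u) (w := w) (by omega)
  obtain ⟨-, -, -, -, h⟩ := hF.transfer hS hu hw hxu hxw hne (Or.inl hue)
  exact h ⟨hue, hwd⟩

lemma adj_of_mixed (hS : CliqueSetup S R f s c) (hF : CliqueOptimal S R f F) {u w x u' : V}
    (hu : u ∈ R) (hw : w ∈ R) (hue : f u < deg F u) (hwd : deg F w < f w) (hxu : F.Adj x u)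
    (hxw : x ≠ w) (hu' : u' ∈ R) (hu'c : f u' = c) (hne : x ≠ u') : F.Adj x u' := by
  by_contra hxu'
  have hxw' : F.Adj x w := by
    by_contra hxw'
    obtain ⟨-, -, -, -, h⟩ := hF.transfer hS hu hw hxu hxw' hxw (Or.inl hue)
    exact h ⟨hue, hwd⟩
  have hlt := hF.lt_of_mixed hS hu hw hue hwd
  have hwc := hS.R_le w hw
  obtain ⟨F', hF', -, h2, h3⟩ := hF.transfer hS hu hu' hxu hxu' hne (Or.inl hue)
  have huu' : u' ≠ u := by rintro rfl; omega
  have hwu' : w ≠ u' := by rintro rfl; exact hxu' hxw'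
  have hwu : w ≠ u := by rintro rfl; omega
  have h4 := h2 u'
  have h5 := h2 w
  rw [if_neg huu', if_pos rfl] at h4
  rw [if_neg hwu, if_neg hwu'] at h5
  have := hF'.lt_of_mixed hS hu' hw (by omega) (by omega)
  omega

lemma not_mixed (hS : CliqueSetup S R f s c) (hF : CliqueOptimal S R f F) {u w : V}
    (hu : u ∈ R) (hw : w ∈ R) (hue : f u < deg F u) (hwd : deg F w < f w) : False := by
  have hlt := hF.lt_of_mixed hS hu hw hue hwd
  have hwc := hS.R_le w hw
  have hNR : ∀ x, F.Adj x u → x ∈ R := by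
    intro x hx
    refine (hF.supp x u hx).resolve_left fun hxS => ?_
    obtain ⟨u', hu', hu'c, hn⟩ := hF.exists_not_adj hS hxS
    have hxR := hS.disj x hxS
    exact hn (hF.adj_of_mixed hS hu hw hue hwd hx (by rintro rfl; exact hxR hw) hu' hu'c
      (by rintro rfl; exact hxR hu'))
  rcases hS.cases with ⟨h1, h2⟩ | ⟨h1, h2⟩
  · have hsub : nbrs F u ⊆ R.erase u := fun x hx => by
      rw [mem_nbrs] at hx
      exact Finset.mem_erase.2 ⟨hx.ne', hNR x hx.symm⟩
    have h3 := Finset.card_le_card hsub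
    rw [← deg_eq_card, Finset.card_erase_of_mem hu, h1] at h3
    have := h2 u hu
    have := Finset.card_pos.2 ⟨u, hu⟩
    omega
  · have hpos := hS.R_pos u hu
    obtain ⟨x, hx, hxw⟩ : ∃ x ∈ nbrs F u, x ≠ w :=
      Finset.exists_mem_ne (by rw [← deg_eq_card]; omega) w
    rw [mem_nbrs] at hx
    have hxR := hNR x hx.symm
    obtain ⟨-, -, -, hdx⟩ := hF.delete hS hu hxR hx hue
    have hsub : Insert.insert u ((R.filter (fun r => f r = c)).erase x) ⊆ nbrs F x := by
      intro b hb
      rw [mem_nbrs]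
      rcases Finset.mem_insert.1 hb with rfl | hb
      · exact hx.symm
      · simp only [Finset.mem_erase, Finset.mem_filter] at hb
        exact hF.adj_of_mixed hS hu hw hue hwd hx.symm hxw hb.2.1 hb.2.2 hb.1.symm
    have h3 := Finset.card_le_card hsub
    rw [← deg_eq_card, Finset.card_insert_of_notMem] at h3
    · have h4 := Finset.pred_card_le_card_erase (s := R.filter (fun r => f r = c)) (a := x)
      have := hS.R_le x hxR
      omega
    · simp only [Finset.mem_erase, Finset.mem_filter, not_and]
      intros
      omega

lemma not_adj_of_excess (hS : CliqueSetup S R f s c) (hF : CliqueOptimal S R f F) {u r : V}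
    (hu : u ∈ R) (hr : r ∈ R) (hue : f u < deg F u) : ¬ F.Adj u r := by
  intro hur
  obtain ⟨F', hF', h2, h3⟩ := hF.delete hS hu hr hur hue
  have h4 := h2 r
  rw [if_neg hur.ne', if_pos rfl] at h4
  refine hS.parity (F := F) (u := u) (Or.inl fun z => ?_)
  by_cases hzS : z ∈ S
  · rw [if_neg (by rintro rfl; exact hS.disj z hzS hu), hF.degS z hzS, add_zero]
  by_cases hzR : z ∈ R
  · have h5 : ¬ deg F z < f z := fun h => hF.not_mixed hS hu hzR hue h
    have h6 : ¬ f z < deg F' z := fun h => hF'.not_mixed hS hzR hr h (by omega)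
    have h7 := h2 z
    by_cases hzu : z = u
    · subst hzu
      rw [if_pos rfl, if_neg hur.ne] at h7
      rw [if_pos rfl]
      omega
    · by_cases hzr : z = r
      · subst hzr
        rw [if_neg hzu]
        omega
      · rw [if_neg hzu, if_neg hzr] at h7
        rw [if_neg hzu]
        omega
  · rw [if_neg (by rintro rfl; exact hzR hu), hF.deg_eq_zero hzS hzR, hS.zero z hzS hzR]

lemma adj_of_deficit (hS : CliqueSetup S R f s c) (hF : CliqueOptimal S R f F) {w r : V}
    (hw : w ∈ R) (hr : r ∈ R) (hwd : deg F w < f w) (hne : w ≠ r) : F.Adj w r := by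
  by_contra hwr
  obtain ⟨F', hF', h2, h3⟩ := hF.insert hS hw hr hwr hne hwd
  have h4 := h2 r
  rw [if_neg hne.symm, if_pos rfl] at h4
  refine hS.parity (F := F) (u := w) (Or.inr fun z => ?_)
  by_cases hzS : z ∈ S
  · rw [if_neg (by rintro rfl; exact hS.disj z hzS hw), hF.degS z hzS, add_zero]
  by_cases hzR : z ∈ R
  · have h5 : ¬ f z < deg F z := fun h => hF.not_mixed hS hzR hw h hwd
    have h6 : ¬ deg F' z < f z := fun h => hF'.not_mixed hS hr hzR (by omega) h
    have h7 := h2 z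
    by_cases hzu : z = w
    · subst hzu
      rw [if_pos rfl, if_neg hne] at h7
      rw [if_pos rfl]
      omega
    · by_cases hzr : z = r
      · subst hzr
        rw [if_neg hzu]
        omega
      · rw [if_neg hzu, if_neg hzr] at h7
        rw [if_neg hzu]
        omega
  · rw [if_neg (by rintro rfl; exact hzR hw), hF.deg_eq_zero hzS hzR, hS.zero z hzS hzR]

end CliqueOptimal

namespace CliqueOptimal

lemma not_excess_of_eq (hS : CliqueSetup S R f s c) (hF : CliqueOptimal S R f F) {u : V}
    (hu : u ∈ R) (huc : f u = c) (hue : f u < deg F u) : False := by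
  have hsub : nbrs F u ⊆ S := fun x hx => by
    rw [mem_nbrs] at hx
    exact (hF.supp x u hx.symm).resolve_right
      fun hxR => hF.not_adj_of_excess hS hu hxR hue hx
  have h1 := Finset.card_le_card hsub
  rw [← deg_eq_card, hS.cardS] at h1
  have h2 := hS.s_le
  have heq : nbrs F u = S :=
    Finset.eq_of_subset_of_card_le hsub (by rw [← deg_eq_card, hS.cardS]; omega)
  obtain ⟨a, ha, hac⟩ := hS.exists_eq
  have hsub' : Insert.insert u (S.erase a) ⊆ nbrs F a := by
    intro b hb
    rw [mem_nbrs]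
    rcases Finset.mem_insert.1 hb with rfl | hb
    · rw [← heq, mem_nbrs] at ha
      exact ha.symm
    · rw [Finset.mem_erase] at hb
      exact hF.clique a ha b hb.2 hb.1.symm
  have h3 := Finset.card_le_card hsub'
  rw [← deg_eq_card, hF.degS a ha, Finset.card_insert_of_notMem
    (fun h => hS.disj u (Finset.mem_of_mem_erase h) hu), Finset.card_erase_of_mem ha, hS.cardS] at h3
  omega

lemma not_excess (hS : CliqueSetup S R f s c) (hF : CliqueOptimal S R f F) {u : V}
    (hu : u ∈ R) (hue : f u < deg F u) : False := by
  by_cases huc : f u = c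
  · exact hF.not_excess_of_eq hS hu huc hue
  obtain ⟨i, hi⟩ : (nbrs F u).Nonempty := by
    rw [← Finset.card_pos, ← deg_eq_card]
    omega
  rw [mem_nbrs] at hi
  have hiS : i ∈ S := (hF.supp i u hi.symm).resolve_right
    fun hiR => hF.not_adj_of_excess hS hu hiR hue hi
  obtain ⟨u', hu', hu'c, hn⟩ := hF.exists_not_adj hS hiS
  obtain ⟨F', hF', -, h2, h3⟩ := hF.transfer hS hu hu' hi.symm hn
    (by rintro rfl; exact hS.disj i hiS hu') (Or.inl hue)
  have h4 := h2 u'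
  rw [if_neg (by rintro rfl; exact huc hu'c), if_pos rfl] at h4
  exact hF'.not_excess_of_eq hS hu' hu'c (by omega)

lemma adj_of_exists_deficit (hS : CliqueSetup S R f s c) (hF : CliqueOptimal S R f F)
    (hR : R.card = s) (hRf : ∀ r ∈ R, s ≤ f r + 1) {w r r' : V}
    (hw : w ∈ R) (hwd : deg F w < f w) (hr : r ∈ R) (hr' : r' ∈ R) (hne : r ≠ r') :
    F.Adj r r' := by
  by_contra hrr'
  have hrd : ¬ deg F r < f r := fun h => hrr' (hF.adj_of_deficit hS hr hr' h hne)
  have hrd' : ¬ deg F r' < f r' :=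
    fun h => hrr' (hF.adj_of_deficit hS hr' hr h hne.symm).symm
  have hre : ¬ f r < deg F r := fun h => hF.not_excess hS hr h
  have hwr : w ≠ r := by rintro rfl; exact hrd hwd
  have hwr' : w ≠ r' := by rintro rfl; exact hrd' hwd
  have hpos := hS.R_pos r hr
  have hSw : ∀ i ∈ S, F.Adj i r → F.Adj i w := by
    intro i hi hir
    by_contra hiw
    obtain ⟨F', hF', h1, h2, -⟩ := hF.transfer hS hr hw hir hiw
      (by rintro rfl; exact hS.disj i hi hw) (Or.inr hwd)
    have h3 := h2 r
    rw [if_pos rfl, if_neg hwr.symm] at h3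
    have h4 := hF'.adj_of_deficit hS hr hr' (by omega) hne
    rw [h1] at h4
    have := hS.disj i hi
    grind
  obtain ⟨i, hi, hir⟩ : ∃ i ∈ S, F.Adj i r := by
    by_contra! hcon
    have hsub : nbrs F r ⊆ (R.erase r).erase r' := fun x hx => by
      rw [mem_nbrs] at hx
      refine Finset.mem_erase.2 ⟨by rintro rfl; exact hrr' hx, Finset.mem_erase.2 ⟨hx.ne', ?_⟩⟩
      exact (hF.supp x r hx.symm).resolve_left fun h => hcon x h hx.symm
    have h1 := Finset.card_le_card hsub
    have hr'' : r' ∈ R.erase r := Finset.mem_erase.2 ⟨hne.symm, hr'⟩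
    have := Finset.card_pos.2 ⟨r', hr''⟩
    rw [← deg_eq_card, Finset.card_erase_of_mem hr'', Finset.card_erase_of_mem hr] at h1
    rw [Finset.card_erase_of_mem hr] at this
    have := hRf r hr
    omega
  obtain ⟨u, hu, huc, hiu⟩ := hF.exists_not_adj hS hi
  have hiw := hSw i hi hir
  have hur : u ≠ r := by rintro rfl; exact hiu hir
  have hwu : w ≠ u := by rintro rfl; exact hiu hiw
  have hiR := hS.disj i hi
  have hiu' : i ≠ u := by rintro rfl; exact hiR hu
  by_cases hud : deg F u < f u
  · obtain ⟨F', hF', h1, h2, -⟩ := hF.transfer hS hr hu hir hiu hiu' (Or.inr hud)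
    have h3 := h2 r
    rw [if_pos rfl, if_neg hur.symm] at h3
    have h4 := hF'.adj_of_deficit hS hr hr' (by omega) hne
    rw [h1] at h4
    grind
  have hue : ¬ f u < deg F u := fun h => hF.not_excess hS hu h
  obtain ⟨F₁, hF₁, h1, h2⟩ := hF.toCliqueAdmissible.transfer hS hr hu hir hiu hiu'
  have hur1 := h2 r
  have huu1 := h2 u
  have huw1 := h2 w
  rw [if_pos rfl, if_neg hur.symm] at hur1
  rw [if_neg hur, if_pos rfl] at huu1
  rw [if_neg hwr, if_neg hwu] at huw1
  have hwc := hS.R_le w hw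
  obtain ⟨x, hxu, hxw, hxw'⟩ := exists_adj_of_deg_lt (G := F₁) (a := u) (w := w) (by omega)
  obtain ⟨F₂, hF₂, h3, h4⟩ := hF₁.transfer hS hu hw hxu hxw hxw'
  have hur2 := h4 r
  have huw2 := h4 w
  rw [if_neg hur.symm, if_neg hwr.symm] at hur2
  rw [if_neg hwu, if_pos rfl] at huw2
  obtain ⟨h5, -⟩ := hF.compare hF₂ hr hw hwr.symm (fun z hz hz' => by
    have h6 := h2 z
    have h7 := h4 z
    rw [if_neg hz] at h6
    rw [if_neg hz'] at h7
    omega) (by simp only [degError]; omega)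
  have h6 := h5.adj_of_deficit hS hr hr' (by omega) hne
  rw [h3, h1] at h6
  grind

lemma not_deficit (hS : CliqueSetup S R f s c) (hF : CliqueOptimal S R f F) {w : V}
    (hw : w ∈ R) (hwd : deg F w < f w) : False := by
  rcases hS.cases with ⟨hR, hRf⟩ | ⟨h1, h2⟩
  · have hd : ∀ r ∈ R, deg F r = s - 1 + (Finset.bipartiteAbove F.Adj S r).card := by
      intro r hr
      have : nbrs F r = R.erase r ∪ Finset.bipartiteAbove F.Adj S r := by
        ext x
        simp only [mem_nbrs, Finset.mem_union, Finset.mem_erase, Finset.mem_bipartiteAbove]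
        refine ⟨fun h => ?_, ?_⟩
        · rcases hF.supp x r h.symm with hx | hx
          · exact Or.inr ⟨hx, h⟩
          · exact Or.inl ⟨h.ne', hx⟩
        · rintro (⟨hx, hxR⟩ | ⟨-, h⟩)
          · exact hF.adj_of_exists_deficit hS hR hRf hw hwd hr hxR hx.symm
          · exact h
      rw [deg_eq_card, this, Finset.card_union_of_disjoint, Finset.card_erase_of_mem hr, hR]
      rw [Finset.disjoint_left]
      intro a ha ha'
      exact hS.disj a ((Finset.mem_bipartiteAbove _).1 ha').1 (Finset.mem_of_mem_erase ha)
    have hb : ∀ i ∈ S, c + 1 ≤ s + (Finset.bipartiteBelow F.Adj R i).card := by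
      intro i hi
      have hsub : nbrs F i ⊆ S.erase i ∪ Finset.bipartiteBelow F.Adj R i := by
        intro x hx
        simp only [mem_nbrs, Finset.mem_union, Finset.mem_erase,
          Finset.mem_bipartiteBelow] at hx ⊢
        rcases hF.supp x i hx.symm with h | h
        · exact Or.inl ⟨hx.ne', h⟩
        · exact Or.inr ⟨h, hx.symm⟩
      have h1 := (Finset.card_le_card hsub).trans (Finset.card_union_le _ _)
      rw [← deg_eq_card, hF.degS i hi, Finset.card_erase_of_mem hi, hS.cardS] at h1
      have := hS.S_ge i hi
      have := Finset.card_pos.2 ⟨i, hi⟩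
      have := hS.cardS
      omega
    have h1 := Finset.sum_card_bipartiteAbove_eq_sum_card_bipartiteBelow (s := R) (t := S) F.Adj
    have h2 : ∑ r ∈ R, deg F r = s * (s - 1) +
        ∑ r ∈ R, (Finset.bipartiteAbove F.Adj S r).card := by
      rw [Finset.sum_congr rfl hd, Finset.sum_add_distrib, Finset.sum_const, hR, smul_eq_mul]
    have h3 : s * (c + 1) ≤ s * s + ∑ i ∈ S, (Finset.bipartiteBelow F.Adj R i).card := by
      have := Finset.sum_le_sum hb
      rwa [Finset.sum_const, Finset.sum_add_distrib, Finset.sum_const, hS.cardS,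
        smul_eq_mul, smul_eq_mul] at this
    have h4 : ∑ r ∈ R, deg F r < s * c := by
      calc ∑ r ∈ R, deg F r < ∑ r ∈ R, f r :=
            Finset.sum_lt_sum (fun r hr => not_lt.1 fun h => hF.not_excess hS hr h) ⟨w, hw, hwd⟩
        _ ≤ ∑ _r ∈ R, c := Finset.sum_le_sum hS.R_le
        _ = s * c := by rw [Finset.sum_const, hR, smul_eq_mul]
    obtain ⟨k, rfl⟩ : ∃ k, s = k + 1 := ⟨s - 1, by
      have := Finset.card_pos.2 ⟨w, hw⟩
      omega⟩
    rw [Nat.add_sub_cancel] at h2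
    nlinarith
  · have hsub : R.erase w ⊆ nbrs F w := fun x hx => by
      rw [Finset.mem_erase] at hx
      rw [mem_nbrs]
      exact hF.adj_of_deficit hS hw hx.2 hwd hx.1.symm
    have h3 := Finset.card_le_card hsub
    rw [← deg_eq_card, Finset.card_erase_of_mem hw] at h3
    have h4 := Finset.card_filter_le R (fun r => f r = c)
    have := hS.R_le w hw
    omega

end CliqueOptimal

lemma CliqueSetup.exists_admissible (hS : CliqueSetup S R f s c) :
    ∃ F, CliqueAdmissible S R f F := by
  have hT : ∀ i, ∃ T ⊆ R, i ∈ S → T.card = f i - (s - 1) := by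
    intro i
    by_cases hi : i ∈ S
    · have h1 := hS.S_le i hi
      have h2 := Finset.card_filter_le R (fun r => f r = c)
      obtain ⟨T, hT, hT'⟩ := Finset.exists_subset_card_eq
        (show f i - (s - 1) ≤ R.card by omega)
      exact ⟨T, hT, fun _ => hT'⟩
    · exact ⟨∅, by simp, fun h => absurd h hi⟩
  choose T hTR hTc using hT
  let F : SimpleGraph V :=
    { Adj := fun a b => (a ∈ S ∧ b ∈ S ∧ a ≠ b) ∨ (a ∈ S ∧ b ∈ T a) ∨ (b ∈ S ∧ a ∈ T b)
      symm := ⟨fun a b h => by rw [ne_comm]; tauto⟩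
      loopless := ⟨fun a h => by
        have h1 := hS.disj a
        have h2 := @hTR a a
        tauto⟩ }
  have hadj : ∀ a b, F.Adj a b ↔
      (a ∈ S ∧ b ∈ S ∧ a ≠ b) ∨ (a ∈ S ∧ b ∈ T a) ∨ (b ∈ S ∧ a ∈ T b) := fun a b => Iff.rfl
  refine ⟨F, fun a ha b hb hab => (hadj a b).2 (Or.inl ⟨ha, hb, hab⟩), fun a b hab => ?_,
    fun a ha => ?_⟩
  · rcases (hadj a b).1 hab with h | h | h
    · exact Or.inl h.1
    · exact Or.inl h.1
    · exact Or.inr (hTR b h.2)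
  · have : nbrs F a = S.erase a ∪ T a := by
      ext x
      have h1 := hS.disj a ha
      have h2 := @hTR x a
      simp only [mem_nbrs, hadj, Finset.mem_union, Finset.mem_erase]
      grind
    rw [deg_eq_card, this, Finset.card_union_of_disjoint, Finset.card_erase_of_mem ha, hTc a ha,
      hS.cardS]
    · have := hS.S_ge a ha
      have := hS.s_le
      omega
    · rw [Finset.disjoint_left]
      intro x hx hx'
      exact hS.disj x (Finset.mem_of_mem_erase hx) (hTR a hx')

lemma CliqueSetup.exists_clique (hS : CliqueSetup S R f s c) :
    ∃ F : SimpleGraph V, (∀ v, deg F v = f v) ∧ ∀ a ∈ S, ∀ b ∈ S, a ≠ b → F.Adj a b := by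
  obtain ⟨F, hF, hmin⟩ := (measure fun F => ∑ v ∈ R, degError f F v).wf.has_min
    {F | CliqueAdmissible S R f F} hS.exists_admissible
  have hopt : CliqueOptimal S R f F := ⟨hF, fun F' hF' => not_lt.1 (hmin F' hF')⟩
  refine ⟨F, fun v => ?_, hF.clique⟩
  by_cases hvS : v ∈ S
  · exact hF.degS v hvS
  by_cases hvR : v ∈ R
  · exact le_antisymm (not_lt.1 fun h => hopt.not_excess hS hvR h)
      (not_lt.1 fun h => hopt.not_deficit hS hvR h)
  · rw [hF.deg_eq_zero hvS hvR, hS.zero v hvS hvR]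

end Construction

section CliqueTheorem

variable {V : Type} [Fintype V]

/-- Every vertex of `S` has at least the degree of every vertex outside `S`. -/
def IsTopSet (G : SimpleGraph V) (S : Finset V) : Prop :=
  ∀ a ∈ S, ∀ w ∉ S, deg G w ≤ deg G a

/-- The degrees of `G` have a realization in which `S` is a clique. -/
def HasCliqueRearrangement (G : SimpleGraph V) (S : Finset V) : Prop :=
  ∃ G' : SimpleGraph V, (∀ v, deg G' v = deg G v) ∧ ∀ a ∈ S, ∀ b ∈ S, a ≠ b → G'.Adj a b

lemma deg_lt_card (G : SimpleGraph V) (v : V) : deg G v < Fintype.card V := by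
  rw [deg_eq_card]
  have h : nbrs G v ⊂ Finset.univ := by
    rw [Finset.ssubset_univ_iff]
    intro h
    exact G.irrefl (mem_nbrs.1 (h ▸ Finset.mem_univ v))
  exact Finset.card_lt_card h

/-- Lay off a vertex of `S` of maximum degree: either the rest of `S` stays on top, or the degrees
are constant around the boundary of `S`. -/
lemma IsTopSet.layOff_max {G : SimpleGraph V} {S : Finset V} (htop : IsTopSet G S)
    (hne : S.Nonempty) (hdeg : ∀ a ∈ S, S.card ≤ deg G a + 1) :
    (∃ (v : V) (G' : SimpleGraph V), v ∈ S ∧ deg G' v = 0 ∧ (∀ z, deg G' z ≤ deg G z) ∧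
      (∀ z, z ≠ v → deg G z ≤ deg G' z + 1) ∧ IsTopSet G' (S.erase v) ∧
      (HasCliqueRearrangement G' (S.erase v) → HasCliqueRearrangement G S)) ∨
    ∃ c, (∀ r ∉ S, deg G r ≤ c) ∧ (∀ i ∈ S, c ≤ deg G i) ∧ (∃ a ∈ S, deg G a = c) ∧
      (∃ w, w ∉ S ∧ deg G w = c) ∧
      ∀ i ∈ S, deg G i + 2 ≤
        (Finset.univ.filter (fun r => r ∉ S ∧ deg G r = c)).card + S.card := by
  obtain ⟨v, hvS, hmax⟩ := Finset.exists_max_image S (deg G) hne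
  have hpos := Finset.card_pos.2 hne
  obtain ⟨B₀, hB₀, hB₀c, hB₀top⟩ := exists_top_subset (deg G) Sᶜ (deg G v + 1 - S.card) (by
    have := deg_lt_card G v
    rw [Finset.card_compl]
    omega)
  have hdv := hdeg v hvS
  have hdisj : Disjoint (S.erase v) B₀ := by
    rw [Finset.disjoint_left]
    intro x hx hx'
    exact Finset.mem_compl.1 (hB₀ hx') (Finset.mem_of_mem_erase hx)
  have hvB : v ∉ S.erase v ∪ B₀ := by
    simp only [Finset.mem_union, Finset.mem_erase, ne_eq, not_true_eq_false, false_and, false_or]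
    exact fun h => Finset.mem_compl.1 (hB₀ h) hvS
  obtain ⟨G', h1, h2, h3⟩ := exists_layOff G hvB (by
    rw [Finset.card_union_of_disjoint hdisj, Finset.card_erase_of_mem hvS, hB₀c]
    omega) (by
    intro b hb x hx hxv
    simp only [Finset.mem_union, Finset.mem_erase, not_or, not_and] at hx
    have hxS := hx.1 hxv
    rcases Finset.mem_union.1 hb with hb | hb
    · exact htop b (Finset.mem_of_mem_erase hb) x hxS
    · exact hB₀top b hb x (Finset.mem_compl.2 hxS) hx.2)
  by_cases htop' : IsTopSet G' (S.erase v)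
  · refine Or.inl ⟨v, G', hvS, h1, fun z => ?_, fun z hz => ?_, htop', ?_⟩
    · by_cases hz : z = v
      · rw [hz, h1]
        exact Nat.zero_le _
      · have := h2 z hz
        omega
    · have := h2 z hz
      split_ifs at this <;> omega
    · rintro ⟨G₁, hG₁, hcl⟩
      obtain ⟨G₂, hG₂, hle, hv⟩ := h3 G₁ hG₁
      refine ⟨G₂, hG₂, fun a ha b hb hab => ?_⟩
      by_cases hav : a = v
      · subst hav
        exact hv b (Finset.mem_union_left _ (Finset.mem_erase.2 ⟨hab.symm, hb⟩))
      by_cases hbv : b = v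
      · subst hbv
        exact (hv a (Finset.mem_union_left _ (Finset.mem_erase.2 ⟨hab, ha⟩))).symm
      · exact hle (hcl a (Finset.mem_erase.2 ⟨hav, ha⟩) b (Finset.mem_erase.2 ⟨hbv, hb⟩) hab)
  · right
    simp only [IsTopSet, not_forall, not_le] at htop'
    obtain ⟨a, ha, w, hw, hlt⟩ := htop'
    have hwv : w ≠ v := by
      rintro rfl
      omega
    have hwS : w ∉ S := fun h => hw (Finset.mem_erase.2 ⟨hwv, h⟩)
    have haS := Finset.mem_of_mem_erase ha
    have h4 := h2 a (Finset.ne_of_mem_erase ha)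
    rw [if_pos (Finset.mem_union_left _ ha)] at h4
    have h5 := h2 w hwv
    have h6 := htop a haS w hwS
    have hwB : w ∉ S.erase v ∪ B₀ := by
      intro h
      rw [if_pos h] at h5
      omega
    rw [if_neg hwB] at h5
    have hwB₀ : w ∉ B₀ := fun h => hwB (Finset.mem_union_right _ h)
    have hwa : deg G w = deg G a := by omega
    refine ⟨deg G a, fun r hr => htop a haS r hr, fun i hi => hwa ▸ htop i hi w hwS,
      ⟨a, haS, rfl⟩, ⟨w, hwS, hwa⟩, fun i hi => ?_⟩
    have hsub : insert w B₀ ⊆ Finset.univ.filter (fun r => r ∉ S ∧ deg G r = deg G a) := by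
      intro x hx
      simp only [Finset.mem_filter, Finset.mem_univ, true_and]
      rcases Finset.mem_insert.1 hx with rfl | hx
      · exact ⟨hwS, hwa⟩
      · have hxS := Finset.mem_compl.1 (hB₀ hx)
        exact ⟨hxS, le_antisymm (htop a haS x hxS)
          (hwa ▸ hB₀top x hx w (Finset.mem_compl.2 hwS) hwB₀)⟩
    have h7 := Finset.card_le_card hsub
    rw [Finset.card_insert_of_notMem hwB₀, hB₀c] at h7
    have := hmax i hi
    omega

/-- Lay off a vertex `w` outside `S` keeping `S` on top. -/
lemma IsTopSet.layOff_notMem {G : SimpleGraph V} {S : Finset V} (htop : IsTopSet G S) {w : V}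
    (hw : w ∉ S) :
    ∃ G' : SimpleGraph V, deg G' w = 0 ∧ (∀ z, deg G' z ≤ deg G z) ∧ IsTopSet G' S ∧
      (∀ k, deg G w ≤ ((Finset.univ.filter (fun z => k ≤ deg G z)).erase w).card →
        ∀ z, z ≠ w → k ≤ deg G z + 1 → k ≤ deg G' z + 1) ∧
      (HasCliqueRearrangement G' S → HasCliqueRearrangement G S) := by
  obtain ⟨B, hB, hBc, hBtop⟩ := exists_top_subset
    (fun x => 2 * deg G x + if x ∈ S then 0 else 1) (Finset.univ.erase w) (deg G w) (by
      have := deg_lt_card G w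
      rw [Finset.card_erase_of_mem (Finset.mem_univ w), Finset.card_univ]
      omega)
  have hwB : w ∉ B := fun h => Finset.ne_of_mem_erase (hB h) rfl
  have hBtop' : ∀ b ∈ B, ∀ x ∉ B, x ≠ w → deg G x ≤ deg G b := by
    intro b hb x hx hxw
    have := hBtop b hb x (Finset.mem_erase.2 ⟨hxw, Finset.mem_univ x⟩) hx
    split_ifs at this <;> omega
  obtain ⟨G', h1, h2, h3⟩ := exists_layOff G hwB hBc hBtop'
  refine ⟨G', h1, fun z => ?_, fun a ha z hz => ?_, fun k hk z hzw hkz => ?_, ?_⟩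
  · by_cases hz : z = w
    · rw [hz, h1]
      exact Nat.zero_le _
    · have := h2 z hz
      omega
  · by_cases hzw : z = w
    · rw [hzw, h1]
      exact Nat.zero_le _
    have h4 := h2 z hzw
    have h5 := h2 a (by rintro rfl; exact hw ha)
    have h6 := htop a ha z hz
    by_cases haB : a ∈ B
    · by_cases hzB : z ∈ B
      · rw [if_pos hzB] at h4
        rw [if_pos haB] at h5
        omega
      · have := hBtop a haB z (Finset.mem_erase.2 ⟨hzw, Finset.mem_univ z⟩) hzB
        rw [if_neg hz, if_pos ha] at this
        rw [if_neg hzB] at h4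
        rw [if_pos haB] at h5
        omega
    · rw [if_neg haB] at h5
      omega
  · have h4 := h2 z hzw
    by_cases hzB : z ∈ B
    · rw [if_pos hzB] at h4
      have : k ≤ deg G z := by
        by_contra! hlt
        have hsub : (Finset.univ.filter (fun z => k ≤ deg G z)).erase w ⊆ B.erase z := by
          intro x hx
          simp only [Finset.mem_erase, Finset.mem_filter, Finset.mem_univ, true_and] at hx ⊢
          refine ⟨by rintro rfl; omega, ?_⟩
          by_contra hxB
          have := hBtop' z hzB x hxB hx.1
          omega
        have := Finset.card_le_card hsub
        rw [Finset.card_erase_of_mem hzB, hBc] at this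
        have := Finset.card_pos.2 ⟨z, hzB⟩
        omega
      omega
    · rw [if_neg hzB] at h4
      omega
  · rintro ⟨G₁, hG₁, hcl⟩
    obtain ⟨G₂, hG₂, hle, -⟩ := h3 G₁ hG₁
    exact ⟨G₂, hG₂, fun a ha b hb hab => hle (hcl a ha b hb hab)⟩

lemma card_pos_deg_lt {G G' : SimpleGraph V} {v : V} (hv : 0 < deg G v) (hv' : deg G' v = 0)
    (hle : ∀ z, deg G' z ≤ deg G z) :
    (Finset.univ.filter (fun z => 0 < deg G' z)).card <
      (Finset.univ.filter (fun z => 0 < deg G z)).card := by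
  apply Finset.card_lt_card
  rw [Finset.ssubset_iff_of_subset]
  · exact ⟨v, by simp [hv], by simp [hv']⟩
  · intro z hz
    simp only [Finset.mem_filter, Finset.mem_univ, true_and] at hz ⊢
    have := hle z
    omega

theorem hasCliqueRearrangement_of_isTopSet (G : SimpleGraph V) (S : Finset V)
    (htop : IsTopSet G S)
    (hcard : 2 * S.card ≤ (Finset.univ.filter (fun v => S.card ≤ deg G v + 1)).card) :
    HasCliqueRearrangement G S := by
  induction hm : (Finset.univ.filter (fun v => 0 < deg G v)).card using Nat.strong_induction_on
    generalizing G S with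
  | _ m ih =>
  by_cases hs : S.card ≤ 1
  · exact ⟨G, fun _ => rfl, fun a ha b hb hab =>
      absurd (Finset.card_le_one.1 hs a ha b hb) hab⟩
  have hSA : ∀ a ∈ S, S.card ≤ deg G a + 1 := by
    intro a ha
    by_contra! hlt
    have hsub : Finset.univ.filter (fun v => S.card ≤ deg G v + 1) ⊆ S := by
      intro x hx
      simp only [Finset.mem_filter, Finset.mem_univ, true_and] at hx
      by_contra hxS
      have := htop a ha x hxS
      omega
    have := Finset.card_le_card hsub
    omega
  rcases htop.layOff_max (Finset.card_pos.1 (by omega)) hSA with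
    ⟨v, G', hvS, h1, h2, h3, h4, h5⟩ | ⟨c, hRc, hSc, ⟨a, haS, hac⟩, ⟨w₀, hw₀, hw₀c⟩, hR₀⟩
  · refine h5 (ih _ ?_ G' _ h4 ?_ rfl)
    · rw [← hm]
      have := hSA v hvS
      exact card_pos_deg_lt (by omega) h1 h2
    · rw [Finset.card_erase_of_mem hvS]
      have hsub : (Finset.univ.filter (fun v => S.card ≤ deg G v + 1)).erase v ⊆
          Finset.univ.filter (fun v => S.card - 1 ≤ deg G' v + 1) := by
        intro x hx
        simp only [Finset.mem_erase, Finset.mem_filter, Finset.mem_univ, true_and] at hx ⊢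
        have := h3 x hx.1
        omega
      have h6 := Finset.card_le_card hsub
      have h7 := Finset.pred_card_le_card_erase
        (s := Finset.univ.filter (fun v => S.card ≤ deg G v + 1)) (a := v)
      omega
  · have hca := hSA a haS
    set R := Finset.univ.filter (fun r => r ∉ S ∧ 0 < deg G r) with hR
    have hmemR : ∀ r, r ∈ R ↔ r ∉ S ∧ 0 < deg G r := fun r => by simp [hR]
    obtain ⟨w, hwR, hmin⟩ := Finset.exists_min_image R (deg G)
      ⟨w₀, (hmemR w₀).2 ⟨hw₀, by omega⟩⟩
    obtain ⟨hwS, hwpos⟩ := (hmemR w).1 hwR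
    have hR₀eq : Finset.univ.filter (fun r => r ∉ S ∧ deg G r = c) =
        R.filter (fun r => deg G r = c) := by
      ext r
      simp only [Finset.mem_filter, Finset.mem_univ, true_and, hmemR]
      refine ⟨fun h => ⟨⟨h.1, by omega⟩, h.2⟩, fun h => ⟨h.1.1, h.2⟩⟩
    have hsetup : ((R.card = S.card ∧ ∀ r ∈ R, S.card ≤ deg G r + 1) ∨
        (c + 1 = S.card ∧ S.card ≤ (R.filter (fun r => deg G r = c)).card)) →
        HasCliqueRearrangement G S := by
      intro h
      exact CliqueSetup.exists_clique (S := S) (R := R) (f := deg G) (s := S.card) (c := c)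
        { disj := fun v hv hv' => ((hmemR v).1 hv').1 hv
          zero := fun v hv hv' => by
            rw [hmemR, not_and, not_lt, Nat.le_zero] at hv'
            exact hv' hv
          even := even_sum_deg G
          cardS := rfl
          s_le := by omega
          R_pos := fun r hr => ((hmemR r).1 hr).2
          R_le := fun r hr => hRc r ((hmemR r).1 hr).1
          S_ge := hSc
          exists_eq := ⟨a, haS, hac⟩
          S_le := by rwa [hR₀eq] at hR₀
          cases := h }
    by_cases hδ : deg G w ≤
        ((Finset.univ.filter (fun z => S.card ≤ deg G z)).erase w).card
    · obtain ⟨G', h1, h2, h3, h4, h5⟩ := htop.layOff_notMem hwS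
      have hsub : (Finset.univ.filter (fun v => S.card ≤ deg G v + 1)).erase w ⊆
          Finset.univ.filter (fun v => S.card ≤ deg G' v + 1) := by
        intro x hx
        simp only [Finset.mem_erase, Finset.mem_filter, Finset.mem_univ, true_and] at hx ⊢
        exact h4 _ hδ x hx.1 hx.2
      by_cases hcard' : 2 * S.card ≤
          (Finset.univ.filter (fun v => S.card ≤ deg G' v + 1)).card
      · exact h5 (ih _ (hm ▸ card_pos_deg_lt hwpos h1 h2) G' S h3 hcard' rfl)
      · have h6 := Finset.card_le_card hsub
        have hwA : w ∈ Finset.univ.filter (fun v => S.card ≤ deg G v + 1) := by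
          by_contra hwA
          rw [Finset.erase_eq_of_notMem hwA] at h6
          omega
        rw [Finset.card_erase_of_mem hwA] at h6
        simp only [Finset.mem_filter, Finset.mem_univ, true_and] at hwA
        refine hsetup (Or.inl ⟨?_, fun r hr => hwA.trans (by have := hmin r hr; omega)⟩)
        have hA : Finset.univ.filter (fun v => S.card ≤ deg G v + 1) = S ∪ R := by
          ext x
          simp only [Finset.mem_filter, Finset.mem_univ, true_and, Finset.mem_union, hmemR]
          refine ⟨fun hx => or_iff_not_imp_left.2 fun hxS => ⟨hxS, by omega⟩, ?_⟩
          rintro (hx | hx)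
          · exact hSA x hx
          · have := hmin x ((hmemR x).2 hx)
            omega
        rw [hA, Finset.card_union_of_disjoint] at hcard h6
        · omega
        · rw [Finset.disjoint_left]
          exact fun x hx hx' => ((hmemR x).1 hx').1 hx
        · rw [Finset.disjoint_left]
          exact fun x hx hx' => ((hmemR x).1 hx').1 hx
    · have hwc := hRc w hwS
      have hws : deg G w < S.card := by
        by_contra! hle
        apply hδ
        rw [deg_eq_card]
        apply Finset.card_le_card
        intro x hx
        have hwx := mem_nbrs.1 hx
        simp only [Finset.mem_erase, Finset.mem_filter, Finset.mem_univ, true_and]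
        refine ⟨hwx.ne', ?_⟩
        by_cases hxS : x ∈ S
        · have := hSc x hxS
          omega
        · have hxpos : 0 < deg G x := by
            rw [deg_eq_card, Finset.card_pos]
            exact ⟨w, mem_nbrs.2 hwx.symm⟩
          have := hmin x ((hmemR x).2 ⟨hxS, hxpos⟩)
          omega
      have hcs : c + 1 = S.card := by
        by_contra hne
        apply hδ
        have hsub : S ⊆ (Finset.univ.filter (fun z => S.card ≤ deg G z)).erase w := by
          intro x hx
          simp only [Finset.mem_erase, Finset.mem_filter, Finset.mem_univ, true_and]
          have := hSc x hx
          exact ⟨by rintro rfl; exact hwS hx, by omega⟩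
        have := Finset.card_le_card hsub
        omega
      refine hsetup (Or.inr ⟨hcs, ?_⟩)
      have hsub : Finset.univ.filter (fun v => S.card ≤ deg G v + 1) ⊆
          S ∪ R.filter (fun r => deg G r = c) := by
        intro x hx
        simp only [Finset.mem_filter, Finset.mem_univ, true_and, Finset.mem_union, hmemR] at hx ⊢
        refine or_iff_not_imp_left.2 fun hxS => ?_
        have := hRc x hxS
        exact ⟨⟨hxS, by omega⟩, by omega⟩
      have := (Finset.card_le_card hsub).trans (Finset.card_union_le _ _)
      omega

end CliqueTheorem

section Tree

/-- A tree can be oriented towards any vertex `ρ` by a parent map along which a rank decreases. -/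
lemma SimpleGraph.IsTree.exists_parent {W : Type} [Fintype W] {T : SimpleGraph W} (hT : T.IsTree)
    (ρ : W) :
    ∃ (par : W → W) (rank : W → ℕ),
      (∀ a, a ≠ ρ → T.Adj a (par a) ∧ rank (par a) < rank a) ∧
      ∀ a b, T.Adj a b → (a ≠ ρ ∧ par a = b) ∨ (b ≠ ρ ∧ par b = a) := by
  have hstep : ∀ a, ∃ b, a ≠ ρ → T.Adj a b ∧ T.dist b ρ < T.dist a ρ := by
    intro a
    by_cases ha : a = ρ
    · exact ⟨a, fun h => absurd ha h⟩
    obtain ⟨p, hp⟩ := hT.connected.exists_walk_length_eq_dist a ρ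
    cases p with
    | nil => exact absurd rfl ha
    | cons h q =>
      refine ⟨_, fun _ => ⟨h, ?_⟩⟩
      have := dist_le q
      rw [Walk.length_cons] at hp
      omega
  choose par hpar using hstep
  refine ⟨par, fun a => T.dist a ρ, hpar, fun a b hab => ?_⟩
  have hinj : Set.InjOn (fun a => s(a, par a)) (Finset.univ.erase ρ : Finset W) := by
    intro x hx y hy hxy
    simp only [Finset.coe_erase, Finset.coe_univ, Set.mem_sdiff, Set.mem_univ, true_and,
      Set.mem_singleton_iff] at hx hy
    rcases Sym2.eq_iff.1 hxy with h | h
    · exact h.1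
    · have h1 := (hpar x hx).2
      have h2 := (hpar y hy).2
      rw [h.2] at h1
      rw [← h.1] at h2
      omega
  have hsub : (Finset.univ.erase ρ).image (fun a => s(a, par a)) ⊆ T.edgeFinset := by
    intro e he
    simp only [Finset.mem_image, Finset.mem_erase, Finset.mem_univ, and_true] at he
    obtain ⟨x, hx, rfl⟩ := he
    rw [mem_edgeFinset, mem_edgeSet]
    exact (hpar x hx).1
  have heq := Finset.eq_of_subset_of_card_le hsub (by
    rw [Finset.card_image_of_injOn hinj, Finset.card_erase_of_mem (Finset.mem_univ ρ),
      Finset.card_univ, ← hT.card_edgeFinset, Nat.add_sub_cancel])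
  have hmem : s(a, b) ∈ T.edgeFinset := by rwa [mem_edgeFinset, mem_edgeSet]
  rw [← heq] at hmem
  simp only [Finset.mem_image, Finset.mem_erase, Finset.mem_univ, and_true] at hmem
  obtain ⟨x, hx, hxe⟩ := hmem
  rcases Sym2.eq_iff.1 hxe with ⟨rfl, rfl⟩ | ⟨rfl, rfl⟩
  · exact Or.inl ⟨hx, rfl⟩
  · exact Or.inr ⟨hx, rfl⟩

lemma exists_deg_ne_one {W : Type} [Fintype W] {T : SimpleGraph W} (hT : T.IsTree)
    (hcard : Fintype.card W ≠ 2) : ∃ ρ, deg T ρ ≠ 1 := by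
  by_contra! hcon
  have h : ∀ v, T.degree v = 1 := fun v => by
    rw [← card_neighborSet_eq_degree, ← Nat.card_eq_fintype_card]
    exact hcon v
  have h1 := T.sum_degrees_eq_twice_card_edges
  have h2 := hT.card_edgeFinset
  simp only [h, Finset.sum_const, Finset.card_univ, smul_eq_mul, mul_one] at h1
  omega

variable {V W : Type} [Fintype V] {t s : ℕ}

/-- A partial embedding into the set `P` of vertices of large degree can be extended along an edge,
after a rearrangement. -/
lemma exists_extend {G : SimpleGraph V} {P X : Finset V} (hV : Fintype.card V + 2 = t + s)
    (hP : ∀ p ∈ P, t ≤ deg G p + 1) (hQ : ∀ q ∉ P, deg G q + 1 < t) (hXP : X ⊆ P)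
    (hlt : X.card < P.card) (hX : X.card + s + 2 ≤ t) {v : V} (hv : v ∈ X) :
    ∃ G' : SimpleGraph V, (∀ z, deg G' z = deg G z) ∧
      (∀ x ∈ X, ∀ y ∈ X, G.Adj x y → G'.Adj x y) ∧ ∃ u ∈ P, u ∉ X ∧ G'.Adj u v := by
  by_cases hex : ∃ u ∈ P, u ∉ X ∧ G.Adj u v
  · exact ⟨G, fun _ => rfl, fun _ _ _ _ h => h, hex⟩
  push Not at hex
  have hnon : ∀ Y : Finset V, v ∉ Y → (∀ y ∈ Y, ¬ G.Adj v y) → Y.card + 2 ≤ s := by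
    intro Y hvY hY
    have hd : Disjoint (insert v Y) (nbrs G v) := by
      rw [Finset.disjoint_left]
      intro y hy hy'
      rw [mem_nbrs] at hy'
      rcases Finset.mem_insert.1 hy with rfl | hy
      · exact G.irrefl hy'
      · exact hY y hy hy'
    have h1 := Finset.card_le_univ (insert v Y ∪ nbrs G v)
    rw [Finset.card_union_of_disjoint hd, Finset.card_insert_of_notMem hvY, ← deg_eq_card] at h1
    have := hP v (hXP hv)
    omega
  have h1 := hnon (P \ X) (fun h => (Finset.mem_sdiff.1 h).2 hv) (fun y hy h =>
    hex y (Finset.mem_sdiff.1 hy).1 (Finset.mem_sdiff.1 hy).2 h.symm)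
  rw [Finset.card_sdiff_of_subset hXP] at h1
  obtain ⟨u, hu⟩ : (P \ X).Nonempty := by
    rw [← Finset.card_pos, Finset.card_sdiff_of_subset hXP]
    omega
  rw [Finset.mem_sdiff] at hu
  obtain ⟨x, hx, hvx⟩ : ∃ x ∉ P, G.Adj v x := by
    by_contra! hcon
    have h2 := hnon Pᶜ (fun h => Finset.mem_compl.1 h (hXP hv))
      (fun y hy => hcon y (Finset.mem_compl.1 hy))
    rw [Finset.card_compl] at h2
    omega
  have h3 := hP u hu.1
  have h4 := hQ x hx
  obtain ⟨y, hyu, hyx, hne⟩ := exists_adj_of_deg_lt (G := G) (a := u) (w := x) (by omega)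
  have hvu : ¬ G.Adj v u := fun h => hex u hu.1 hu.2 h.symm
  obtain ⟨G', h5, h6⟩ := exists_twoSwitch hvx hyu.symm hvu (by rintro rfl; exact hu.2 hv)
    (fun h => hyx h.symm) hne.symm
  refine ⟨G', h6, fun a ha b hb hab => (h5 a b).2 (Or.inl ⟨hab, ?_⟩), u, hu.1, hu.2,
    (h5 u v).2 (Or.inr (Or.inr (Or.inl ⟨rfl, rfl⟩)))⟩
  have := hXP ha
  have := hXP hb
  grind

/-- Embed an upward closed part `J` of a rooted tree into the vertices of large degree. -/
lemma exists_embedding_core {G : SimpleGraph V} {P : Finset V} (hs : 2 ≤ s)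
    (hV : Fintype.card V + 2 = t + s)
    (hP : ∀ p ∈ P, t ≤ deg G p + 1) (hQ : ∀ q ∉ P, deg G q + 1 < t) {ρ : W} {par : W → W}
    {rank : W → ℕ} (hrank : ∀ a, a ≠ ρ → rank (par a) < rank a) (J : Finset W)
    (hJ : ∀ a ∈ J, a ≠ ρ → par a ∈ J) (hJP : J.card ≤ P.card) (hJt : J.card + s + 1 ≤ t) :
    ∃ (G' : SimpleGraph V) (φ : W → V), (∀ z, deg G' z = deg G z) ∧ Set.InjOn φ J ∧
      (∀ a ∈ J, φ a ∈ P) ∧ ∀ a ∈ J, a ≠ ρ → G'.Adj (φ a) (φ (par a)) := by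
  induction hk : J.card generalizing J with
  | zero =>
    rw [Finset.card_eq_zero] at hk
    subst hk
    have hne : Nonempty V := Fintype.card_pos_iff.1 (by omega)
    exact ⟨G, fun _ => Classical.choice hne, fun _ => rfl, by simp, by simp, by simp⟩
  | succ k ih =>
    obtain ⟨a, ha, hmax⟩ := Finset.exists_max_image J rank (Finset.card_pos.1 (by omega))
    have hpar : ∀ b ∈ J, b ≠ ρ → par b ∈ J.erase a := by
      intro b hb hbρ
      refine Finset.mem_erase.2 ⟨?_, hJ b hb hbρ⟩
      rintro rfl
      have := hmax b hb
      have := hrank b hbρ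
      omega
    have hcard : (J.erase a).card = k := by rw [Finset.card_erase_of_mem ha, hk, Nat.add_sub_cancel]
    obtain ⟨G₁, φ, h1, h2, h3, h4⟩ := ih (J.erase a)
      (fun b hb hbρ => hpar b (Finset.mem_of_mem_erase hb) hbρ) (by omega) (by omega) hcard
    have hXc : ((J.erase a).image φ).card = k := by rw [Finset.card_image_of_injOn h2, hcard]
    have hXP : (J.erase a).image φ ⊆ P := by
      intro x hx
      obtain ⟨b, hb, rfl⟩ := Finset.mem_image.1 hx
      exact h3 b hb
    obtain ⟨G₂, h5, h6, u, huP, huX, hu⟩ : ∃ G₂ : SimpleGraph V, (∀ z, deg G₂ z = deg G₁ z) ∧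
        (∀ x ∈ (J.erase a).image φ, ∀ y ∈ (J.erase a).image φ, G₁.Adj x y → G₂.Adj x y) ∧
        ∃ u ∈ P, u ∉ (J.erase a).image φ ∧ (a ≠ ρ → G₂.Adj u (φ (par a))) := by
      by_cases haρ : a = ρ
      · obtain ⟨u, hu⟩ : (P \ (J.erase a).image φ).Nonempty := by
          rw [← Finset.card_pos, Finset.card_sdiff_of_subset hXP]
          omega
        rw [Finset.mem_sdiff] at hu
        exact ⟨G₁, fun _ => rfl, fun _ _ _ _ h => h, u, hu.1, hu.2, fun h => absurd haρ h⟩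
      · obtain ⟨G₂, h5, h6, u, huP, huX, hu⟩ := exists_extend (G := G₁) hV (by simpa only [h1] using hP)
          (by simpa only [h1] using hQ) hXP (by omega) (by omega)
          (Finset.mem_image_of_mem φ (hpar a ha haρ))
        exact ⟨G₂, h5, h6, u, huP, huX, fun _ => hu⟩
    have hoff : ∀ b ∈ J.erase a, Function.update φ a u b = φ b :=
      fun b hb => Function.update_of_ne (Finset.ne_of_mem_erase hb) _ _
    refine ⟨G₂, Function.update φ a u, fun z => by rw [h5, h1], ?_, fun b hb => ?_,
      fun b hb hbρ => ?_⟩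
    · rw [← Finset.insert_erase ha, Finset.coe_insert,
        Set.injOn_insert (by simp)]
      refine ⟨fun x hx y hy hxy => h2 hx hy ?_, ?_⟩
      · rwa [hoff x hx, hoff y hy] at hxy
      · rintro ⟨b, hb, hbu⟩
        rw [hoff b hb, Function.update_self] at hbu
        exact huX (Finset.mem_image.2 ⟨b, hb, hbu⟩)
    · by_cases hba : b = a
      · rw [hba, Function.update_self]
        exact huP
      · have hb' := Finset.mem_erase.2 ⟨hba, hb⟩
        rw [hoff b hb']
        exact h3 b hb'
    · have hpb := hpar b hb hbρ
      rw [hoff _ hpb]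
      by_cases hba : b = a
      · subst hba
        rw [Function.update_self]
        exact hu hbρ
      · have hb' := Finset.mem_erase.2 ⟨hba, hb⟩
        rw [hoff b hb']
        exact h6 _ (Finset.mem_image_of_mem φ hb') _ (Finset.mem_image_of_mem φ hpb)
          (h4 b hb' hbρ)

/-- Extend an embedding of the inner vertices `I` greedily to the leaves. -/
lemma exists_embedding_leaves [Fintype W] {G : SimpleGraph V} {P : Finset V}
    (hP : ∀ p ∈ P, Fintype.card W ≤ deg G p + 1) {ρ : W} {par : W → W} {I : Finset W}
    (hρ : ρ ∈ I) (hpar : ∀ a, a ≠ ρ → par a ∈ I) {φ : W → V} (hinj : Set.InjOn φ I)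
    (hφP : ∀ a ∈ I, φ a ∈ P) (hφ : ∀ a ∈ I, a ≠ ρ → G.Adj (φ a) (φ (par a))) (K : Finset W) :
    ∃ ψ : W → V, Set.InjOn ψ ((I ∪ K : Finset W) : Set W) ∧ (∀ a ∈ I, ψ a ∈ P) ∧
      ∀ a ∈ I ∪ K, a ≠ ρ → G.Adj (ψ a) (ψ (par a)) := by
  induction K using Finset.induction_on with
  | empty => exact ⟨φ, by simpa using hinj, hφP, by simpa using hφ⟩
  | insert a K haK ih =>
    obtain ⟨ψ, h1, h2, h3⟩ := ih
    by_cases ha : a ∈ I ∪ K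
    · have : I ∪ insert a K = I ∪ K := by
        rw [Finset.union_insert, Finset.insert_eq_of_mem ha]
      rw [this]
      exact ⟨ψ, h1, h2, h3⟩
    have haI : a ∉ I := fun h => ha (Finset.mem_union_left _ h)
    have haρ : a ≠ ρ := by rintro rfl; exact haI hρ
    have hpa := hpar a haρ
    obtain ⟨u, hu, huX⟩ : ∃ u ∈ nbrs G (ψ (par a)), u ∉ (I ∪ K).image ψ := by
      by_contra! hcon
      have hmem : par a ∈ I ∪ K := Finset.mem_union_left _ hpa
      have hsub : insert (ψ (par a)) (nbrs G (ψ (par a))) ⊆ (I ∪ K).image ψ :=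
        Finset.insert_subset (Finset.mem_image_of_mem ψ hmem) hcon
      have h4 := (Finset.card_le_card hsub).trans Finset.card_image_le
      rw [Finset.card_insert_of_notMem (by simp), ← deg_eq_card] at h4
      have h5 := Finset.card_lt_card (Finset.ssubset_univ_iff.2
        (fun h => ha (h ▸ Finset.mem_univ a) : I ∪ K ≠ Finset.univ))
      rw [Finset.card_univ] at h5
      have := hP _ (h2 _ hpa)
      omega
    rw [mem_nbrs] at hu
    have hoff : ∀ b ∈ I ∪ K, Function.update ψ a u b = ψ b :=
      fun b hb => Function.update_of_ne (by rintro rfl; exact ha hb) _ _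
    refine ⟨Function.update ψ a u, ?_, fun b hb => ?_, fun b hb hbρ => ?_⟩
    · rw [Finset.union_insert, Finset.coe_insert, Set.injOn_insert (by exact_mod_cast ha)]
      refine ⟨fun x hx y hy hxy => h1 hx hy ?_, ?_⟩
      · rwa [hoff x hx, hoff y hy] at hxy
      · rintro ⟨b, hb, hbu⟩
        rw [hoff b hb, Function.update_self] at hbu
        exact huX (Finset.mem_image.2 ⟨b, hb, hbu⟩)
    · rw [hoff b (Finset.mem_union_left _ hb)]
      exact h2 b hb
    · rw [hoff _ (Finset.mem_union_left _ (hpar b hbρ))]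
      rw [Finset.union_insert, Finset.mem_insert] at hb
      rcases hb with rfl | hb
      · rw [Function.update_self]
        exact hu.symm
      · rw [hoff b hb]
        exact h3 b hb hbρ

end Tree

section Main

lemma deg_compl {V : Type} [Fintype V] (G : SimpleGraph V) (v : V) :
    deg Gᶜ v = Fintype.card V - 1 - deg G v := by
  have h : nbrs Gᶜ v = (insert v (nbrs G v))ᶜ := by
    ext x
    simp only [mem_nbrs, compl_adj, Finset.mem_compl, Finset.mem_insert, not_or]
    rw [ne_comm, ne_eq]
  rw [deg_eq_card, h, Finset.card_compl, Finset.card_insert_of_notMem (by simp), ← deg_eq_card]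
  omega

lemma deg_comap_equiv {V V' : Type} [Fintype V] [Fintype V'] (G : SimpleGraph V) (e : V' ≃ V)
    (v : V') : deg (G.comap e) v = deg G (e v) := by
  have h : nbrs G (e v) = (nbrs (G.comap e) v).map e.toEmbedding := by
    ext x
    simp only [mem_nbrs, Finset.mem_map_equiv, comap_adj, Equiv.apply_symm_apply]
  rw [deg_eq_card, deg_eq_card, h, Finset.card_map]

lemma potentiallyGraphic_compSeq_top {n s : ℕ} {π : Fin n → ℕ} (hg : Graphic π)
    (hcard : 2 * s ≤ (Finset.univ.filter (fun i => s ≤ n - 1 - π i + 1)).card) :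
    PotentiallyGraphic (compSeq π) (⊤ : SimpleGraph (Fin s)) := by
  obtain ⟨G, hG⟩ := hg
  have hdeg : ∀ i, deg Gᶜ i = n - 1 - π i := fun i => by
    rw [deg_compl, hG i, Fintype.card_fin]
  obtain ⟨S, -, hS, htop⟩ := exists_top_subset (deg Gᶜ) (Finset.univ : Finset (Fin n)) s (by
    have := Finset.card_le_univ (Finset.univ.filter (fun i => s ≤ n - 1 - π i + 1))
    rw [Finset.card_univ]
    omega)
  obtain ⟨F, hF, hcl⟩ := hasCliqueRearrangement_of_isTopSet Gᶜ S
    (fun a ha w hw => htop a ha w (Finset.mem_univ w) hw) (by simpa only [hS, hdeg] using hcard)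
  refine ⟨F.comap Fin.revPerm, fun i => ?_,
    ⟨(S.equivFinOfCardEq hS).symm.toEmbedding.trans
      ((Function.Embedding.subtype _).trans Fin.revPerm.toEmbedding), fun x y hxy => ?_⟩⟩
  · rw [deg_comap_equiv, hF, hdeg]
    rfl
  · simp only [comap_adj, Function.Embedding.trans_apply, Equiv.coe_toEmbedding,
      Fin.revPerm_apply, Fin.rev_rev, Function.Embedding.subtype_apply]
    refine hcl _ (Subtype.coe_prop _) _ (Subtype.coe_prop _) fun h => hxy ?_
    exact (S.equivFinOfCardEq hS).symm.injective (Subtype.ext h)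

lemma potentiallyGraphic_tree {t s n : ℕ} {W : Type} [Fintype W] {T : SimpleGraph W}
    (hT : T.IsTree) (hcard : Fintype.card W = t) (hs : 2 ≤ s) (hn : n + 2 = t + s)
    (hleaves : s + 1 ≤ numLeaves T) {π : Fin n → ℕ} (hg : Graphic π)
    (hP : t ≤ (Finset.univ.filter (fun i => t ≤ π i + 1)).card + s + 1) :
    PotentiallyGraphic π T := by
  obtain ⟨G, hG⟩ := hg
  obtain ⟨ρ, hρ⟩ := exists_deg_ne_one hT (by
    have h := Finite.card_subtype_le (fun a => deg T a = 1)
    rw [Nat.card_eq_fintype_card (α := W)] at h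
    rw [numLeaves] at hleaves
    omega)
  obtain ⟨par, rank, hpar, hadj⟩ := hT.exists_parent ρ
  set I := Finset.univ.filter (fun a => deg T a ≠ 1) with hI
  set P := Finset.univ.filter (fun i => t ≤ π i + 1) with hPdef
  have hIc : I.card + s + 1 ≤ t := by
    have h1 := Finset.card_filter_add_card_filter_not (s := (Finset.univ : Finset W))
      (fun a => deg T a = 1)
    rw [numLeaves, Nat.card_eq_fintype_card, Fintype.card_subtype] at hleaves
    rw [Finset.card_univ, hcard] at h1
    change _ + I.card = t at h1
    omega
  have hparI : ∀ a, a ≠ ρ → par a ∈ I := by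
    intro a ha
    simp only [hI, Finset.mem_filter, Finset.mem_univ, true_and]
    by_cases hpa : par a = ρ
    · rwa [hpa]
    · intro h1
      rw [deg_eq_card, Finset.card_eq_one] at h1
      obtain ⟨x, hx⟩ := h1
      have h2 : a ∈ nbrs T (par a) := mem_nbrs.2 (hpar a ha).1.symm
      have h3 : par (par a) ∈ nbrs T (par a) := mem_nbrs.2 (hpar _ hpa).1
      rw [hx, Finset.mem_singleton] at h2 h3
      have h4 := (hpar a ha).2
      have h5 := (hpar _ hpa).2
      rw [h3, ← h2] at h5
      omega
  have hPG : ∀ p ∈ P, t ≤ deg G p + 1 := fun p hp => by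
    rw [hG p]
    exact (Finset.mem_filter.1 hp).2
  obtain ⟨G', φ, h1, h2, h3, h4⟩ := exists_embedding_core (G := G) (P := P) (t := t) (s := s) hs
    (by rwa [Fintype.card_fin]) hPG (fun q hq => by
      simp only [hPdef, Finset.mem_filter, Finset.mem_univ, true_and, not_le] at hq
      rwa [hG q]) (fun a ha => (hpar a ha).2) I (fun a _ ha => hparI a ha) (by omega) hIc
  obtain ⟨ψ, h5, -, h6⟩ := exists_embedding_leaves (G := G') (P := P)
    (by simpa only [h1, hcard] using hPG) (by simpa [hI] using hρ) hparI h2 h3 h4 Finset.univ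
  rw [Finset.union_eq_right.2 (Finset.subset_univ I)] at h5 h6
  have hψ : ∀ a, a ≠ ρ → G'.Adj (ψ a) (ψ (par a)) := fun a => h6 a (Finset.mem_univ a)
  refine ⟨G', fun i => by rw [h1, hG i], ⟨ψ, fun x y hxy => h5 (by simp) (by simp) hxy⟩,
    fun x y hxy => ?_⟩
  rcases hadj x y hxy with ⟨hx, rfl⟩ | ⟨hy, rfl⟩
  · exact hψ x hx
  · exact (hψ y hy).symm

end Main

/-- If T is a tree of order t with at least s+1 leaves (2 ≤ s ≤ t-2), then every graphic
sequence of length t+s-2 is potentially T-graphic or its complement is potentially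
K_s-graphic. -/
theorem many_leaves_case {t s : ℕ} {W : Type} [Fintype W] (T : SimpleGraph W)
    (hT : T.IsTree) (hcard : Fintype.card W = t) (hs : 2 ≤ s) (hst : s ≤ t - 2)
    (hleaves : s + 1 ≤ numLeaves T)
    (π : Fin (t + s - 2) → ℕ) (hmono : Antitone π) (hg : Graphic π) :
    PotentiallyGraphic π T ∨
      PotentiallyGraphic (compSeq π) (⊤ : SimpleGraph (Fin s)) := by
  by_cases h : 2 * s ≤
      (Finset.univ.filter (fun i => s ≤ t + s - 2 - 1 - π i + 1)).card
  · exact Or.inr (potentiallyGraphic_compSeq_top hg h)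
  · refine Or.inl (potentiallyGraphic_tree hT hcard hs (by omega) hleaves hg ?_)
    have h1 := Finset.card_filter_add_card_filter_not (s := (Finset.univ : Finset (Fin (t + s - 2))))
      (fun i => s ≤ t + s - 2 - 1 - π i + 1)
    rw [Finset.card_univ, Fintype.card_fin] at h1
    have h2 : (Finset.univ.filter (fun i => ¬ s ≤ t + s - 2 - 1 - π i + 1)).card ≤
        (Finset.univ.filter (fun i => t ≤ π i + 1)).card :=
      Finset.card_le_card (Finset.monotone_filter_right _ fun i _ hi => by omega)
    omega
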